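/- Unique continuation for pseudoholomorphic curves: Let J be an almost complex structure on ℂⁿ and let u, v : B → ℂⁿ be smooth J-holomorphic curves with u(0) = v(0) = 0 whose partial derivatives at 0 agree to all orders, i.e. for every k ≥ 0 the k-th iterated real Fréchet derivatives of u and v at 0 coincide. Then u ≡ v on some neighborhood of 0. -/

import Mathlib

open Metric Complex
open MeasureTheory Filter Topology InnerProductSpace

section L2Estimate

theorem integrable_fderiv_apply {f : ℂ → ℝ} (hf : ContDiff ℝ 1 f)
    (hc : HasCompactSupport f) (v : ℂ) : Integrable fun z => fderiv ℝ f z v :=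
  ((hf.continuous_fderiv one_ne_zero).clm_apply continuous_const
    ).integrable_of_hasCompactSupport (hc.fderiv_apply ℝ v)

theorem integrable_norm_sq_of_hasCompactSupport {X : Type*} [NormedAddCommGroup X] {f : ℂ → X}
    (hf : Continuous f) (hc : HasCompactSupport f) : Integrable fun z => ‖f z‖ ^ 2 := by
  refine (hf.norm.pow 2).integrable_of_hasCompactSupport (hc.mono fun z hz => ?_)
  contrapose! hz
  simp_all

theorem integral_fderiv_apply_eq_zero {f : ℂ → ℝ} (hf : ContDiff ℝ 1 f)
    (hc : HasCompactSupport f) (v : ℂ) : ∫ z, fderiv ℝ f z v = 0 := by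
  have h := integral_mul_fderiv_eq_neg_fderiv_mul_of_integrable (μ := (volume : Measure ℂ))
    (f := fun _ => (1 : ℝ)) (g := f) (v := v) (by simp)
    (by
      simp only [one_mul]
      exact integrable_fderiv_apply hf hc v)
    (by simpa using hf.continuous.integrable_of_hasCompactSupport hc)
    (fun _ _ => by fun_prop) (fun _ _ => (hf.differentiable one_ne_zero) _)
  simpa using h

theorem integral_norm_sq_fderiv_one_le {g : ℂ → ℂ} (hg : ContDiff ℝ 2 g)
    (hc : HasCompactSupport g) :
    ∫ z, ‖fderiv ℝ g z 1‖ ^ 2 ≤ ∫ z, ‖fderiv ℝ g z 1 + I * fderiv ℝ g z I‖ ^ 2 := by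
  have hg1 : ContDiff ℝ 1 (fderiv ℝ g) := hg.fderiv_right (by norm_num)
  have hd : ∀ v, ContDiff ℝ 1 fun z => fderiv ℝ g z v := fun v => hg1.clm_apply contDiff_const
  have hgd : Differentiable ℝ g := hg.differentiable two_ne_zero
  have hdd : Differentiable ℝ (fderiv ℝ g) := hg1.differentiable one_ne_zero
  have hF : ∀ v, ContDiff ℝ 1 fun z => ⟪g z, I * fderiv ℝ g z v⟫_ℝ := fun v =>
    (hg.of_le one_le_two).inner ℝ (contDiff_const.mul (hd v))
  have hFc : ∀ v, HasCompactSupport fun z => ⟪g z, I * fderiv ℝ g z v⟫_ℝ := fun v =>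
    hc.mono fun z hz => by
      contrapose! hz
      simp_all
  have hFd : ∀ v w z, fderiv ℝ (fun z => ⟪g z, I * fderiv ℝ g z v⟫_ℝ) z w =
      ⟪g z, I * fderiv ℝ (fderiv ℝ g) z w v⟫_ℝ + ⟪fderiv ℝ g z w, I * fderiv ℝ g z v⟫_ℝ := by
    intro v w z
    have h1 := ((hdd z).hasFDerivAt.clm_apply (hasFDerivAt_const v z)).const_mul I
    rw [((hgd z).hasFDerivAt.inner ℝ h1).fderiv]
    simp
  have h0 : ∫ z, ((fderiv ℝ (fun z => ⟪g z, I * fderiv ℝ g z I⟫_ℝ) z 1)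
      - fderiv ℝ (fun z => ⟪g z, I * fderiv ℝ g z 1⟫_ℝ) z I) = 0 := by
    rw [integral_sub, integral_fderiv_apply_eq_zero (hF _) (hFc _),
      integral_fderiv_apply_eq_zero (hF _) (hFc _), sub_zero]
    all_goals exact integrable_fderiv_apply (hF _) (hFc _) _
  have hint : ∀ v, Integrable fun z => ‖fderiv ℝ g z v‖ ^ 2 := fun v =>
    integrable_norm_sq_of_hasCompactSupport (hd v).continuous (hc.fderiv_apply ℝ v)
  have hsum : Integrable fun z => ‖fderiv ℝ g z 1‖ ^ 2 + ‖fderiv ℝ g z I‖ ^ 2 :=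
    (hint 1).add (hint I)
  have hcross : Integrable fun z => (fderiv ℝ (fun z => ⟪g z, I * fderiv ℝ g z I⟫_ℝ) z 1)
      - fderiv ℝ (fun z => ⟪g z, I * fderiv ℝ g z 1⟫_ℝ) z I := by
    apply Integrable.sub
    all_goals exact integrable_fderiv_apply (hF _) (hFc _) _
  have hpt : ∀ z, ‖fderiv ℝ g z 1 + I * fderiv ℝ g z I‖ ^ 2 =
      ‖fderiv ℝ g z 1‖ ^ 2 + ‖fderiv ℝ g z I‖ ^ 2 +
      ((fderiv ℝ (fun z => ⟪g z, I * fderiv ℝ g z I⟫_ℝ) z 1)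
      - fderiv ℝ (fun z => ⟪g z, I * fderiv ℝ g z 1⟫_ℝ) z I) := by
    intro z
    have hs : fderiv ℝ (fderiv ℝ g) z 1 I = fderiv ℝ (fderiv ℝ g) z I 1 :=
      (hg.contDiffAt (x := z)).isSymmSndFDerivAt (by simp) 1 I
    rw [hFd, hFd, hs]
    simp only [← Complex.normSq_eq_norm_sq, Complex.normSq_apply, Complex.inner]
    simp
    ring
  calc ∫ z, ‖fderiv ℝ g z 1‖ ^ 2
      ≤ ∫ z, ‖fderiv ℝ g z 1‖ ^ 2 + ‖fderiv ℝ g z I‖ ^ 2 :=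
        integral_mono (hint 1) hsum fun z => by simp
    _ = ∫ z, ‖fderiv ℝ g z 1 + I * fderiv ℝ g z I‖ ^ 2 := by
        simp_rw [hpt]
        rw [integral_add hsum hcross, h0, add_zero]

theorem integral_norm_sq_le_fderiv_one {g : ℂ → ℂ} (hg : ContDiff ℝ 1 g)
    (hc : HasCompactSupport g) {R : ℝ} (hR : ∀ z, g z ≠ 0 → ‖z‖ ≤ R) :
    ∫ z, ‖g z‖ ^ 2 ≤ 4 * R ^ 2 * ∫ z, ‖fderiv ℝ g z 1‖ ^ 2 := by
  have hgd : Differentiable ℝ g := hg.differentiable one_ne_zero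
  have hf : ContDiff ℝ 1 fun z : ℂ => z.re * ⟪g z, g z⟫_ℝ :=
    Complex.reCLM.contDiff.mul (hg.inner ℝ hg)
  have hfc : HasCompactSupport fun z : ℂ => z.re * ⟪g z, g z⟫_ℝ :=
    hc.mono fun z hz => by
      contrapose! hz
      simp_all
  have hfd : ∀ z, fderiv ℝ (fun z : ℂ => z.re * ⟪g z, g z⟫_ℝ) z 1 =
      ‖g z‖ ^ 2 + 2 * z.re * ⟪g z, fderiv ℝ g z 1⟫_ℝ := by
    intro z
    have h1 := (Complex.reCLM.hasFDerivAt (x := z)).mul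
      ((hgd z).hasFDerivAt.inner ℝ (hgd z).hasFDerivAt)
    have h2 : fderiv ℝ (fun z : ℂ => z.re * ⟪g z, g z⟫_ℝ) z = _ := h1.fderiv
    rw [h2, ← real_inner_self_eq_norm_sq]
    simp [real_inner_comm]
    ring
  have hint : Integrable fun z => ‖g z‖ ^ 2 :=
    integrable_norm_sq_of_hasCompactSupport hg.continuous hc
  have hint1 : Integrable fun z => ‖fderiv ℝ g z 1‖ ^ 2 :=
    integrable_norm_sq_of_hasCompactSupport
      ((hg.continuous_fderiv one_ne_zero).clm_apply continuous_const) (hc.fderiv_apply ℝ 1)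
  have hintf : Integrable fun z => fderiv ℝ (fun z : ℂ => z.re * ⟪g z, g z⟫_ℝ) z 1 :=
    integrable_fderiv_apply hf hfc 1
  have h0 := integral_fderiv_apply_eq_zero hf hfc 1
  have hpt : ∀ z, ‖g z‖ ^ 2 - 2 * fderiv ℝ (fun z : ℂ => z.re * ⟪g z, g z⟫_ℝ) z 1 ≤
      4 * R ^ 2 * ‖fderiv ℝ g z 1‖ ^ 2 := by
    intro z
    rw [hfd]
    by_cases hz : g z = 0
    · have : 0 ≤ 4 * R ^ 2 * ‖fderiv ℝ g z 1‖ ^ 2 := by positivity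
      simpa [hz] using this
    have hzR := (Complex.abs_re_le_norm z).trans (hR z hz)
    have hin := abs_real_inner_le_norm (g z) (fderiv ℝ g z 1)
    have h3 : |z.re * ⟪g z, fderiv ℝ g z 1⟫_ℝ| ≤ R * (‖g z‖ * ‖fderiv ℝ g z 1‖) := by
      rw [abs_mul]
      exact mul_le_mul hzR hin (abs_nonneg _) ((abs_nonneg _).trans hzR)
    have h4 := (abs_le.mp h3).1
    nlinarith [sq_nonneg (‖g z‖ - 2 * R * ‖fderiv ℝ g z 1‖)]
  have := integral_mono (hint.sub (hintf.const_mul 2)) (hint1.const_mul (4 * R ^ 2)) hpt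
  simp only [Pi.sub_apply] at this
  rwa [integral_sub hint (hintf.const_mul 2), integral_const_mul, h0, integral_const_mul,
    mul_zero, sub_zero] at this

variable {ι : Type*} [Fintype ι]

/-- Poincaré-type `L²` estimate for the Cauchy-Riemann operator on compactly supported maps. -/
theorem integral_norm_sq_le_dbar {g : ℂ → EuclideanSpace ℂ ι} (hg : ContDiff ℝ 2 g)
    (hc : HasCompactSupport g) {R : ℝ} (hR : ∀ z, g z ≠ 0 → ‖z‖ ≤ R) :
    ∫ z, ‖g z‖ ^ 2 ≤
      4 * R ^ 2 * ∫ z, ‖fderiv ℝ g z 1 + I • fderiv ℝ g z I‖ ^ 2 := by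
  have hgi : ∀ i, ContDiff ℝ 2 fun z => g z i := fun i =>
    ((EuclideanSpace.proj (𝕜 := ℂ) i).restrictScalars ℝ).contDiff.comp hg
  have hgc : ∀ i, HasCompactSupport fun z => g z i := fun i =>
    hc.comp_left (g := fun x : EuclideanSpace ℂ ι => x i) (by simp)
  have hgd : Differentiable ℝ g := hg.differentiable two_ne_zero
  have hfd : ∀ i z v, fderiv ℝ (fun z => g z i) z v = fderiv ℝ g z v i := by
    intro i z v
    have := ((EuclideanSpace.proj (𝕜 := ℂ) i).restrictScalars ℝ).hasFDerivAt.comp z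
      (hgd z).hasFDerivAt
    have h2 := this.fderiv
    exact DFunLike.congr_fun h2 v
  have hint : ∀ i, Integrable fun z => ‖g z i‖ ^ 2 := fun i =>
    integrable_norm_sq_of_hasCompactSupport (hgi i).continuous (hgc i)
  have hint1 : ∀ i, Integrable fun z =>
      ‖fderiv ℝ (fun z => g z i) z 1 + I * fderiv ℝ (fun z => g z i) z I‖ ^ 2 := fun i => by
    have hcont := (hgi i).continuous_fderiv two_ne_zero
    refine integrable_norm_sq_of_hasCompactSupport (by fun_prop) ?_
    exact ((hgc i).fderiv ℝ).comp_left (g := fun L : ℂ →L[ℝ] ℂ => L 1 + I * L I) (by simp)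
  simp_rw [EuclideanSpace.norm_sq_eq]
  have : ∀ z i, (fderiv ℝ g z 1 + I • fderiv ℝ g z I) i =
      fderiv ℝ (fun z => g z i) z 1 + I * fderiv ℝ (fun z => g z i) z I := by
    intro z i
    simp [hfd]
  simp_rw [this]
  rw [integral_finsetSum _ fun i _ => hint i, integral_finsetSum _ fun i _ => hint1 i,
    Finset.mul_sum]
  refine Finset.sum_le_sum fun i _ => ?_
  refine (integral_norm_sq_le_fderiv_one ((hgi i).of_le one_le_two) (hgc i)
    fun z hz => hR z fun h => hz (by simp [h])).trans ?_
  exact mul_le_mul_of_nonneg_left (integral_norm_sq_fderiv_one_le (hgi i) (hgc i)) (by positivity)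

end L2Estimate

section Carleman

variable {ι : Type*} [Fintype ι]

/-- Carleman inequality with weight `‖z‖ ^ (-N)`, uniform in `N`, for the truncation by `η` of a
solution of a Cauchy-Riemann differential inequality. -/
theorem carleman_inequality {h : ℂ → EuclideanSpace ℂ ι} {U : Set ℂ} (hU : IsOpen U)
    (hh : ContDiffOn ℝ 2 h U) {C R : ℝ} (hRC : 16 * R ^ 2 * C ^ 2 ≤ 1)
    (hD : ∀ z ∈ U, ‖fderiv ℝ h z 1 + I • fderiv ℝ h z I‖ ≤ C * ‖h z‖)
    {η : ℂ → ℝ} (hη : ContDiff ℝ 2 η) (hc : HasCompactSupport η) (hsub : tsupport η ⊆ U)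
    (h0 : (0 : ℂ) ∉ tsupport η) (hR : ∀ z, η z ≠ 0 → ‖z‖ ≤ R) (N : ℕ) {Φ : ℂ → ℝ}
    (hΦ : Integrable Φ)
    (hle : ∀ z, ((‖z‖ ^ N)⁻¹ * (‖fderiv ℝ η z‖ * ‖h z‖)) ^ 2 ≤ Φ z) :
    Integrable (fun z => ((‖z‖ ^ N)⁻¹ * (|η z| * ‖h z‖)) ^ 2) ∧
    ∫ z, ((‖z‖ ^ N)⁻¹ * (|η z| * ‖h z‖)) ^ 2 ≤ 64 * R ^ 2 * ∫ z, Φ z := by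
  set G : ℂ → EuclideanSpace ℂ ι := fun z => (z ^ N)⁻¹ • (η z • h z) with hG
  have hGnorm : ∀ z, ‖G z‖ = (‖z‖ ^ N)⁻¹ * (|η z| * ‖h z‖) := fun z => by
    simp [hG, norm_smul]
  have hGzero : ∀ z ∉ tsupport η, G =ᶠ[𝓝 z] 0 := fun z hz => by
    filter_upwards [notMem_tsupport_iff_eventuallyEq.mp hz] with w hw
    simp [hG, hw]
  have hGsmooth : ContDiff ℝ 2 G := by
    rw [contDiff_iff_contDiffAt]
    intro z
    by_cases hz : z ∈ tsupport η
    · have hz0 : z ≠ 0 := fun h => h0 (h ▸ hz)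
      have h1 : ContDiffAt ℝ 2 h z := hh.contDiffAt (hU.mem_nhds (hsub hz))
      have h2 : ContDiffAt ℝ 2 (fun z : ℂ => (z ^ N)⁻¹) z :=
        (contDiffAt_id.pow N).inv (pow_ne_zero N hz0)
      exact h2.smul (hη.contDiffAt.smul h1)
    · exact (contDiffAt_const (c := 0)).congr_of_eventuallyEq (hGzero z hz)
  have hGc : HasCompactSupport G := hc.mono fun z hz => by
    contrapose! hz
    simp_all
  have hGR : ∀ z, G z ≠ 0 → ‖z‖ ≤ R := fun z hz => hR z fun h => hz (by simp [hG, h])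
  have hDG : ∀ z, ‖fderiv ℝ G z 1 + I • fderiv ℝ G z I‖ ^ 2 ≤
      2 * C ^ 2 * ‖G z‖ ^ 2 + 8 * Φ z := by
    intro z
    by_cases hz : z ∈ tsupport η
    swap
    · have h1 : fderiv ℝ G z = 0 := by
        rw [(hGzero z hz).fderiv_eq]
        simp
      have h2 : 0 ≤ Φ z := (sq_nonneg _).trans (hle z)
      rw [h1]
      have : 0 ≤ 2 * C ^ 2 * ‖G z‖ ^ 2 + 8 * Φ z := by positivity
      simpa using this
    have hz0 : z ≠ 0 := fun h => h0 (h ▸ hz)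
    have h1 : HasFDerivAt h (fderiv ℝ h z) z :=
      ((hh.contDiffAt (hU.mem_nhds (hsub hz))).differentiableAt two_ne_zero).hasFDerivAt
    have h2 : HasFDerivAt η (fderiv ℝ η z) z :=
      (hη.differentiable two_ne_zero z).hasFDerivAt
    obtain ⟨c', hc'⟩ : ∃ c', HasDerivAt (fun z : ℂ => (z ^ N)⁻¹) c' z :=
      ⟨_, (((hasDerivAt_id z).fun_pow N).fun_inv (pow_ne_zero N hz0))⟩
    have h3 := hc'.complexToReal_fderiv
    have h4 : fderiv ℝ G z = _ := (h3.fun_smul (h2.fun_smul h1)).fderiv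
    have h5 : fderiv ℝ G z 1 + I • fderiv ℝ G z I =
        ((z ^ N)⁻¹ * η z) • (fderiv ℝ h z 1 + I • fderiv ℝ h z I) +
        ((z ^ N)⁻¹ * (fderiv ℝ η z 1 + I * fderiv ℝ η z I)) • h z := by
      rw [h4]
      ext i
      simp
      linear_combination (c' * (η z * h z i)) * I_mul_I
    have h6 : ‖(fderiv ℝ η z 1 + I * fderiv ℝ η z I : ℂ)‖ ≤ 2 * ‖fderiv ℝ η z‖ := by
      refine (norm_add_le _ _).trans ?_
      have h7 := (fderiv ℝ η z).le_opNorm 1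
      have h8 := (fderiv ℝ η z).le_opNorm I
      simp only [norm_one, norm_I, mul_one] at h7 h8
      rw [norm_mul, norm_I, one_mul, norm_real, norm_real]
      linarith
    have h9 : ‖fderiv ℝ G z 1 + I • fderiv ℝ G z I‖ ≤
        C * ‖G z‖ + 2 * ((‖z‖ ^ N)⁻¹ * (‖fderiv ℝ η z‖ * ‖h z‖)) := by
      rw [h5]
      refine (norm_add_le _ _).trans (add_le_add ?_ ?_)
      · rw [norm_smul, hGnorm, norm_mul, norm_inv, norm_pow, norm_real, Real.norm_eq_abs]
        calc _ ≤ (‖z‖ ^ N)⁻¹ * |η z| * (C * ‖h z‖) :=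
              mul_le_mul_of_nonneg_left (hD z (hsub hz)) (by positivity)
          _ = _ := by ring
      · rw [norm_smul, norm_mul, norm_inv, norm_pow]
        calc _ ≤ (‖z‖ ^ N)⁻¹ * (2 * ‖fderiv ℝ η z‖) * ‖h z‖ := by gcongr
          _ = _ := by ring
    have h10 := hle z
    calc _ ≤ (C * ‖G z‖ + 2 * ((‖z‖ ^ N)⁻¹ * (‖fderiv ℝ η z‖ * ‖h z‖))) ^ 2 := by gcongr
      _ ≤ _ := by
        nlinarith [sq_nonneg (C * ‖G z‖ - 2 * ((‖z‖ ^ N)⁻¹ * (‖fderiv ℝ η z‖ * ‖h z‖)))]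
  have hint : Integrable fun z => ‖G z‖ ^ 2 :=
    integrable_norm_sq_of_hasCompactSupport hGsmooth.continuous hGc
  have hintD : Integrable fun z => ‖fderiv ℝ G z 1 + I • fderiv ℝ G z I‖ ^ 2 := by
    have hcont := hGsmooth.continuous_fderiv two_ne_zero
    refine integrable_norm_sq_of_hasCompactSupport (by fun_prop) ?_
    exact (hGc.fderiv ℝ).comp_left
      (g := fun L : ℂ →L[ℝ] EuclideanSpace ℂ ι => L 1 + I • L I) (by simp)
  have hmain := integral_norm_sq_le_dbar hGsmooth hGc hGR
  have hmono := integral_mono hintD ((hint.const_mul (2 * C ^ 2)).add (hΦ.const_mul 8)) hDG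
  simp only [Pi.add_apply] at hmono
  rw [integral_add (hint.const_mul (2 * C ^ 2)) (hΦ.const_mul 8), integral_const_mul,
    integral_const_mul] at hmono
  simp_rw [← hGnorm]
  refine ⟨hint, ?_⟩
  have hnn : 0 ≤ ∫ z, ‖G z‖ ^ 2 := integral_nonneg fun z => by positivity
  nlinarith [mul_le_mul_of_nonneg_left hmono (by positivity : 0 ≤ 4 * R ^ 2),
    mul_le_mul_of_nonneg_right hRC hnn]

theorem exists_cutoff : ∃ M : ℝ, 0 ≤ M ∧ ∀ ρ : ℝ, 0 < ρ → ∃ χ : ℂ → ℝ, ContDiff ℝ 2 χ ∧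
    (∀ z, ‖z‖ ≤ ρ → χ z = 1) ∧ (∀ z, 2 * ρ ≤ ‖z‖ → χ z = 0) ∧
    (∀ z, ‖fderiv ℝ χ z‖ ≤ M / ρ) ∧
    (∀ z, ‖z‖ < ρ → fderiv ℝ χ z = 0) ∧ (∀ z, 2 * ρ < ‖z‖ → fderiv ℝ χ z = 0) := by
  let f : ContDiffBump (0 : ℂ) := ⟨1, 2, one_pos, one_lt_two⟩
  have hf : ContDiff ℝ 2 f := f.contDiff
  obtain ⟨M, hM⟩ := (hf.continuous_fderiv two_ne_zero).bounded_above_of_compact_support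
    (f.hasCompactSupport.fderiv ℝ)
  refine ⟨M, (norm_nonneg _).trans (hM 0), fun ρ hρ => ⟨fun z => f (ρ⁻¹ • z), ?_, ?_, ?_, ?_, ?_⟩⟩
  · exact hf.comp (contDiff_const_smul _)
  · intro z hz
    apply f.one_of_mem_closedBall
    simpa [f, norm_smul, abs_of_pos hρ, inv_mul_le_iff₀ hρ] using hz
  · intro z hz
    apply f.zero_of_le_dist
    have : 2 ≤ ρ⁻¹ * ‖z‖ := by rw [le_inv_mul_iff₀ hρ]; linarith
    simpa [f, norm_smul, abs_of_pos hρ] using this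
  · intro z
    rw [fderiv_comp_smul, norm_smul, norm_inv, Real.norm_eq_abs, abs_of_pos hρ, div_eq_inv_mul]
    exact mul_le_mul_of_nonneg_left (hM _) (by positivity)
  constructor
  · intro z hz
    have : (fun z => f (ρ⁻¹ • z)) =ᶠ[𝓝 z] fun _ => 1 := by
      filter_upwards [(isOpen_lt continuous_norm continuous_const).mem_nhds hz] with w hw
      apply f.one_of_mem_closedBall
      have hw' : ‖w‖ ≤ ρ := le_of_lt hw
      simpa [f, norm_smul, abs_of_pos hρ, inv_mul_le_iff₀ hρ] using hw'
    rw [this.fderiv_eq]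
    simp
  · intro z hz
    have : (fun z => f (ρ⁻¹ • z)) =ᶠ[𝓝 z] fun _ => 0 := by
      filter_upwards [(isOpen_lt continuous_const continuous_norm).mem_nhds hz] with w hw
      apply f.zero_of_le_dist
      have hw' : 2 * ρ < ‖w‖ := hw
      have : 2 ≤ ρ⁻¹ * ‖w‖ := by rw [le_inv_mul_iff₀ hρ]; linarith
      simpa [f, norm_smul, abs_of_pos hρ] using this
    rw [this.fderiv_eq]
    simp

end Carleman

section UniqueContinuation

variable {ι : Type*} [Fintype ι]

theorem exists_annular_cutoff_bound {h : ℂ → EuclideanSpace ℂ ι} {ρ H : ℝ} (hρ : 0 < ρ)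
    (hH : ∀ z ∈ closedBall (0 : ℂ) (2 * ρ), ‖h z‖ ≤ H)
    (hflat : ∀ N : ℕ, h =O[𝓝 0] fun z => ‖z‖ ^ N) :
    ∃ B : ℝ, ∀ τ > 0, ∀ N : ℕ, ∃ ε > 0, ∃ η : ℂ → ℝ, ContDiff ℝ 2 η ∧
      (∀ z, η z ≠ 0 → ε ≤ ‖z‖ ∧ ‖z‖ ≤ 2 * ρ) ∧ (∀ z, τ ≤ ‖z‖ → ‖z‖ ≤ ρ → η z = 1) ∧
      ∀ z, (‖z‖ ^ N)⁻¹ * (‖fderiv ℝ η z‖ * ‖h z‖) ≤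
        (closedBall (0 : ℂ) (2 * ρ)).indicator (fun _ => (ρ ^ N)⁻¹ * B) z := by
  have hH0 : 0 ≤ H := (norm_nonneg _).trans (hH 0 (by simp [hρ.le]))
  obtain ⟨M, hM, hcut⟩ := exists_cutoff
  refine ⟨1 + M / ρ * H, fun τ hτ N => ?_⟩
  obtain ⟨K, hK, hb⟩ := (hflat (N + 2)).exists_pos
  obtain ⟨r₁, hr₁, hb⟩ := Metric.eventually_nhds_iff.mp hb.bound
  have hev : ∀ᶠ ε : ℝ in 𝓝[>] 0, (2 * ε < r₁ ∧ 2 * ε < τ ∧ 2 * ε < ρ ∧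
      M * K * 2 ^ (N + 2) * ε < (ρ ^ N)⁻¹) ∧ 0 < ε := by
    refine (eventually_nhdsWithin_of_eventually_nhds ?_).and self_mem_nhdsWithin
    have h1 : ∀ c d : ℝ, 0 < d → ∀ᶠ ε : ℝ in 𝓝 0, c * ε < d := fun c d hd =>
      (by fun_prop : Continuous fun ε : ℝ => c * ε).continuousAt.eventually_lt
        continuousAt_const (by simpa using hd)
    exact (h1 _ _ hr₁).and ((h1 _ _ hτ).and ((h1 _ _ hρ).and (h1 _ _ (by positivity))))
  obtain ⟨ε, ⟨hε1, hε2, hε3, hε4⟩, hε⟩ := hev.exists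
  obtain ⟨χ, hχ, hχ1, hχ0, hχM, hχi, hχo⟩ := hcut ρ hρ
  obtain ⟨ψ, hψ, hψ1, hψ0, hψM, hψi, hψo⟩ := hcut ε hε
  refine ⟨ε, hε, fun z => χ z - ψ z, hχ.sub hψ, ?_, ?_, ?_⟩
  · intro z hz
    change χ z - ψ z ≠ 0 at hz
    constructor
    · by_contra! hlt
      exact hz (by rw [hχ1 z (by linarith), hψ1 z hlt.le, sub_self])
    · by_contra! hlt
      exact hz (by rw [hχ0 z hlt.le, hψ0 z (by linarith), sub_self])
  · intro z h1 h2
    change χ z - ψ z = 1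
    rw [hχ1 z h2, hψ0 z (by linarith), sub_zero]
  intro z
  have hfd : fderiv ℝ (fun z => χ z - ψ z) z = fderiv ℝ χ z - fderiv ℝ ψ z :=
    fderiv_fun_sub (hχ.differentiable two_ne_zero z) (hψ.differentiable two_ne_zero z)
  rw [hfd]
  have hnn : 0 ≤ (closedBall (0 : ℂ) (2 * ρ)).indicator
      (fun _ => (ρ ^ N)⁻¹ * (1 + M / ρ * H)) z :=
    Set.indicator_nonneg (fun _ _ => by positivity) z
  rcases lt_or_ge (2 * ρ) ‖z‖ with hz | hz
  · rw [hχo z hz, hψo z (by linarith)]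
    simpa using hnn
  have hzmem : z ∈ closedBall (0 : ℂ) (2 * ρ) := by simpa using hz
  rw [Set.indicator_of_mem hzmem] at hnn ⊢
  rcases lt_or_ge ‖z‖ ρ with hzρ | hzρ
  · rw [hχi z hzρ, zero_sub, norm_neg]
    rcases lt_or_ge ‖z‖ ε with h1 | h1
    · rw [hψi z h1]
      simpa using hnn
    rcases lt_or_ge (2 * ε) ‖z‖ with h2 | h2
    · rw [hψo z h2]
      simpa using hnn
    have hz0 : 0 < ‖z‖ := hε.trans_le h1
    have h3 : ‖h z‖ ≤ K * ‖z‖ ^ (N + 2) := by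
      simpa using hb (y := z) (by simpa using h2.trans_lt hε1)
    calc (‖z‖ ^ N)⁻¹ * (‖fderiv ℝ ψ z‖ * ‖h z‖)
        ≤ (‖z‖ ^ N)⁻¹ * (M / ε * (K * ‖z‖ ^ (N + 2))) := by
          gcongr
          exact hψM z
      _ = M / ε * K * ‖z‖ ^ 2 := by field_simp; ring
      _ ≤ M / ε * K * (2 * ε) ^ 2 := by gcongr
      _ = M * K * 2 ^ 2 * ε := by field_simp
      _ ≤ M * K * 2 ^ (N + 2) * ε := by
          gcongr
          · norm_num
          · omega
      _ ≤ (ρ ^ N)⁻¹ * 1 := by rw [mul_one]; exact hε4.le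
      _ ≤ (ρ ^ N)⁻¹ * (1 + M / ρ * H) := by
          gcongr
          have : 0 ≤ M / ρ * H := by positivity
          linarith
  · rw [hψo z (by linarith), sub_zero]
    calc (‖z‖ ^ N)⁻¹ * (‖fderiv ℝ χ z‖ * ‖h z‖)
        ≤ (ρ ^ N)⁻¹ * (M / ρ * H) := by
          gcongr
          · exact hχM z
          · exact hH z hzmem
      _ ≤ (ρ ^ N)⁻¹ * (1 + M / ρ * H) := by
          gcongr
          linarith

/-- Unique continuation from infinite-order vanishing for the standard Cauchy-Riemann operator. -/
theorem eqOn_zero_of_norm_dbar_le {h : ℂ → EuclideanSpace ℂ ι} {r C : ℝ} (hr : 0 < r)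
    (hh : ContDiffOn ℝ 2 h (ball 0 r)) (hC : 0 ≤ C)
    (hD : ∀ z ∈ ball 0 r, ‖fderiv ℝ h z 1 + I • fderiv ℝ h z I‖ ≤ C * ‖h z‖)
    (hflat : ∀ N : ℕ, h =O[𝓝 0] fun z => ‖z‖ ^ N) :
    ∃ ε > 0, ∀ z ∈ ball 0 ε, h z = 0 := by
  obtain ⟨ρ, hρ, hρr, hρC⟩ : ∃ ρ > 0, 2 * ρ < r ∧ 8 * (ρ * C) ≤ 1 := by
    refine ⟨min (r / 3) (1 / (8 * (C + 1))), by positivity, ?_, ?_⟩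
    · linarith [min_le_left (r / 3) (1 / (8 * (C + 1)))]
    · have h1 := min_le_right (r / 3) (1 / (8 * (C + 1)))
      rw [le_div_iff₀ (by positivity)] at h1
      have h2 : 0 < min (r / 3) (1 / (8 * (C + 1))) := by positivity
      linarith
  refine ⟨ρ, hρ, fun z₀ hz₀ => ?_⟩
  by_contra hne
  have hz₀0 : z₀ ≠ 0 := by
    rintro rfl
    obtain ⟨K, hK⟩ := (hflat 1).bound
    exact hne (by simpa using hK.self_of_nhds)
  rw [mem_ball_zero_iff] at hz₀
  obtain ⟨σ, hσ₀, hσ⟩ := exists_between hz₀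
  have hzpos : 0 < ‖z₀‖ := norm_pos_iff.mpr hz₀0
  have hσpos : 0 < σ := hzpos.trans hσ₀
  have hnorm : 0 < ‖h z₀‖ := norm_pos_iff.mpr hne
  have hcont : ContinuousAt h z₀ := hh.continuousOn.continuousAt
    (isOpen_ball.mem_nhds (by simp; linarith))
  obtain ⟨r₀, hr₀, hball⟩ : ∃ r₀ > 0, ∀ z ∈ ball z₀ r₀,
      ‖h z₀‖ / 2 < ‖h z‖ ∧ ‖z‖ < σ ∧ ‖z₀‖ / 2 < ‖z‖ :=
    Metric.eventually_nhds_iff_ball.mp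
      ((continuousAt_const.eventually_lt hcont.norm (half_lt_self hnorm)).and
        ((continuous_norm.continuousAt.eventually_lt continuousAt_const hσ₀).and
          (continuousAt_const.eventually_lt continuous_norm.continuousAt (half_lt_self hzpos))))
  obtain ⟨H, hH⟩ := (isCompact_closedBall (0 : ℂ) (2 * ρ)).exists_bound_of_continuousOn
    (hh.continuousOn.mono (closedBall_subset_ball hρr))
  obtain ⟨B, hB⟩ := exists_annular_cutoff_bound hρ hH hflat
  set m₁ := (volume : Measure ℂ).real (ball z₀ r₀)
  set m₂ := (volume : Measure ℂ).real (closedBall 0 (2 * ρ))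
  have hm₁pos : 0 < m₁ :=
    ENNReal.toReal_pos (measure_ball_pos _ _ hr₀).ne' measure_ball_lt_top.ne
  have key : ∀ N : ℕ, m₁ * ((σ ^ N)⁻¹ * (‖h z₀‖ / 2)) ^ 2 ≤
      64 * (2 * ρ) ^ 2 * (m₂ * ((ρ ^ N)⁻¹ * B) ^ 2) := by
    intro N
    obtain ⟨ε, hε, η, hη, hsupp, hη1, hηb⟩ := hB _ (half_pos hzpos) N
    have hts : tsupport η ⊆ {z | ε ≤ ‖z‖ ∧ ‖z‖ ≤ 2 * ρ} :=
      closure_minimal (fun z hz => hsupp z hz)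
        ((isClosed_le continuous_const continuous_norm).inter
          (isClosed_le continuous_norm continuous_const))
    have hc : HasCompactSupport η :=
      (isCompact_closedBall (0 : ℂ) (2 * ρ)).of_isClosed_subset (isClosed_tsupport η)
        fun z hz => by simpa using (hts hz).2
    obtain ⟨hint, hcarl⟩ := carleman_inequality isOpen_ball hh (C := C) (R := 2 * ρ)
      (by nlinarith [mul_nonneg hρ.le hC]) hD hη hc
      (fun z hz => by simpa using (hts hz).2.trans_lt hρr)
      (fun h0 => by simpa [hε] using (hts h0).1.trans_lt' hε) (fun z hz => (hsupp z hz).2) N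
      (Φ := (closedBall (0 : ℂ) (2 * ρ)).indicator (fun _ => ((ρ ^ N)⁻¹ * B) ^ 2))
      ((integrable_indicator_iff measurableSet_closedBall).mpr
        (integrableOn_const measure_closedBall_lt_top.ne))
      (fun z => by
        refine (pow_le_pow_left₀ (by positivity) (hηb z) 2).trans_eq ?_
        by_cases hz : z ∈ closedBall (0 : ℂ) (2 * ρ) <;> simp only [hz, Set.indicator_of_mem,
          not_false_eq_true, Set.indicator_of_notMem, ne_eq, two_ne_zero, zero_pow])
    rw [integral_indicator_const _ measurableSet_closedBall, smul_eq_mul] at hcarl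
    refine le_trans ?_ hcarl
    rw [← smul_eq_mul, ← integral_indicator_const _ measurableSet_ball]
    refine integral_mono ((integrable_indicator_iff measurableSet_ball).mpr
        (integrableOn_const measure_ball_lt_top.ne)) hint fun z => ?_
    by_cases hz : z ∈ ball z₀ r₀
    · obtain ⟨h1, h2, h3⟩ := hball z hz
      have hzp : 0 < ‖z‖ := by linarith
      simp only [hz, Set.indicator_of_mem]
      rw [hη1 z h3.le (h2.trans hσ).le, abs_one, one_mul]
      gcongr
    · simp only [hz, not_false_eq_true, Set.indicator_of_notMem]
      positivity
  have ha : 1 < (ρ / σ) ^ 2 := one_lt_pow₀ ((one_lt_div hσpos).mpr hσ) two_ne_zero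
  obtain ⟨N, hN⟩ := pow_unbounded_of_one_lt
    (64 * (2 * ρ) ^ 2 * (m₂ * B ^ 2) / (m₁ * (‖h z₀‖ / 2) ^ 2)) ha
  rw [div_lt_iff₀ (by positivity)] at hN
  have h1 := mul_le_mul_of_nonneg_left (key N) (by positivity : 0 ≤ (ρ ^ N) ^ 2)
  have h2 : (ρ ^ N) ^ 2 * (m₁ * ((σ ^ N)⁻¹ * (‖h z₀‖ / 2)) ^ 2) =
      ((ρ / σ) ^ 2) ^ N * (m₁ * (‖h z₀‖ / 2) ^ 2) := by
    rw [div_pow, div_pow, ← pow_mul, ← pow_mul, ← pow_mul, mul_comm 2 N]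
    field_simp
    ring
  have h3 : (ρ ^ N) ^ 2 * (64 * (2 * ρ) ^ 2 * (m₂ * ((ρ ^ N)⁻¹ * B) ^ 2)) =
      64 * (2 * ρ) ^ 2 * (m₂ * B ^ 2) := by
    field_simp
  rw [h2, h3] at h1
  linarith

end UniqueContinuation

section Pseudoholomorphic

theorem isBigO_norm_pow_of_iteratedFDeriv_eq_zero.{u} {E F : Type u} [NormedAddCommGroup E]
    [NormedSpace ℝ E] [NormedAddCommGroup F] [NormedSpace ℝ F] {f : E → F}
    (hf : ContDiffAt ℝ (⊤ : ℕ∞) f 0) (h0 : ∀ k : ℕ, iteratedFDeriv ℝ k f 0 = 0) (N : ℕ) :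
    f =O[𝓝 0] fun z => ‖z‖ ^ N := by
  induction N generalizing F with
  | zero => simpa using hf.continuousAt.tendsto.isBigO_one ℝ
  | succ N ih =>
    have hf' : ContDiffAt ℝ (⊤ : ℕ∞) (fderiv ℝ f) 0 := hf.fderiv_right (by simp)
    have h0' : ∀ k : ℕ, iteratedFDeriv ℝ k (fderiv ℝ f) 0 = 0 := fun k => by
      rw [← norm_eq_zero, norm_iteratedFDeriv_fderiv, h0, norm_zero]
    obtain ⟨K, hK⟩ := (ih hf' h0').bound
    have hd : ∀ᶠ z in 𝓝 0, DifferentiableAt ℝ f z :=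
      ((hf.of_le (m := 1) (by simp)).eventually (by simp)).mono
        fun z hz => hz.differentiableAt one_ne_zero
    obtain ⟨δ, hδ, hball⟩ := Metric.eventually_nhds_iff_ball.mp (hd.and hK)
    have hf0 : f 0 = 0 := by
      have := h0 0
      rwa [← norm_eq_zero, norm_iteratedFDeriv_zero, norm_eq_zero] at this
    refine Asymptotics.IsBigO.of_bound |K| ?_
    filter_upwards [ball_mem_nhds 0 hδ] with z hz
    rw [mem_ball_zero_iff] at hz
    have hsub : ∀ x ∈ closedBall (0 : E) ‖z‖, x ∈ ball (0 : E) δ := fun x hx => by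
      rw [mem_closedBall_zero_iff] at hx
      rw [mem_ball_zero_iff]
      exact hx.trans_lt hz
    have hmv := (convex_closedBall (0 : E) ‖z‖).norm_image_sub_le_of_norm_fderiv_le
      (f := f) (C := |K| * ‖z‖ ^ N) (x := 0) (y := z) (fun x hx => (hball x (hsub x hx)).1)
      (fun x hx => by
        refine (hball x (hsub x hx)).2.trans ?_
        rw [mem_closedBall_zero_iff] at hx
        rw [norm_pow, norm_norm]
        gcongr
        exact le_abs_self K) (by simp) (by simp)
    simpa [hf0, pow_succ, mul_assoc] using hmv

/-- A real-linear embedding as a totally real subspace of some `ℂᵐ`. -/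
theorem exists_complexification (E : Type*) [NormedAddCommGroup E] [NormedSpace ℝ E]
    [FiniteDimensional ℝ E] :
    ∃ (m : ℕ) (A : E →L[ℝ] EuclideanSpace ℂ (Fin m)) (K : ℝ), 0 ≤ K ∧
      ∀ x y, ‖x‖ ≤ K * ‖A x - I • A y‖ := by
  let b := (Module.finBasis ℝ E).equivFun.toContinuousLinearEquiv
  let A : E →ₗ[ℝ] EuclideanSpace ℂ (Fin (Module.finrank ℝ E)) :=
    { toFun := fun x => WithLp.toLp 2 fun j => (b x j : ℂ)
      map_add' := fun x y => by ext j; simp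
      map_smul' := fun c x => by ext j; simp }
  refine ⟨_, A.toContinuousLinearMap, ‖b.symm.toContinuousLinearMap‖, norm_nonneg _, fun x y => ?_⟩
  have h1 : ‖b x‖ ≤ ‖A x - I • A y‖ := by
    rw [pi_norm_le_iff_of_nonneg (norm_nonneg _)]
    intro j
    refine le_trans ?_ (PiLp.norm_apply_le _ j)
    have h2 : ((A x - I • A y) j).re = b x j := by simp [A]
    rw [← h2]
    exact Complex.abs_re_le_norm _
  have h3 := b.symm.toContinuousLinearMap.le_opNorm (b x)
  simp only [ContinuousLinearEquiv.coe_coe, ContinuousLinearEquiv.symm_apply_apply] at h3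
  exact h3.trans (mul_le_mul_of_nonneg_left h1 (norm_nonneg _))

theorem eventually_norm_le_of_continuousAt {X : Type*} [NormedAddCommGroup X] {f : ℂ → X}
    {z : ℂ} (hf : ContinuousAt f z) : ∃ c : ℝ, 0 ≤ c ∧ ∀ᶠ x in 𝓝 z, ‖f x‖ ≤ c :=
  ⟨‖f z‖ + 1, by positivity,
    (hf.norm.eventually_lt continuousAt_const (lt_add_one _)).mono fun _ hx => hx.le⟩

variable {E : Type} [NormedAddCommGroup E] [NormedSpace ℝ E]

/-- Unique continuation from infinite-order vanishing for a Cauchy-Riemann operator with variable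
complex structure `T`. -/
theorem eqOn_zero_of_norm_variable_dbar_le [FiniteDimensional ℝ E] {w : ℂ → E}
    {T : ℂ → E →L[ℝ] E} {r C : ℝ} (hr : 0 < r) (hw : ContDiffOn ℝ (⊤ : ℕ∞) w (ball 0 r))
    (hT : ContDiffOn ℝ (⊤ : ℕ∞) T (ball 0 r)) (hsq : ∀ z x, T z (T z x) = -x)
    (hC : 0 ≤ C) (hD : ∀ᶠ z in 𝓝 0, ‖fderiv ℝ w z 1 + T z (fderiv ℝ w z I)‖ ≤ C * ‖w z‖)
    (hflat : ∀ k : ℕ, iteratedFDeriv ℝ k w 0 = 0) :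
    ∃ ε > 0, ∀ z ∈ ball 0 ε, w z = 0 := by
  obtain ⟨m, A, K, hK, hA⟩ := exists_complexification E
  have hw0 : ContDiffAt ℝ (⊤ : ℕ∞) w 0 := hw.contDiffAt (ball_mem_nhds 0 hr)
  have hT0 : ContDiffAt ℝ (⊤ : ℕ∞) T 0 := hT.contDiffAt (ball_mem_nhds 0 hr)
  obtain ⟨c₁, hc₁, hb₁⟩ := eventually_norm_le_of_continuousAt hT0.continuousAt
  obtain ⟨c₂, hc₂, hb₂⟩ := eventually_norm_le_of_continuousAt
    (hT0.fderiv_right (m := 0) (by simp)).continuousAt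
  set h : ℂ → EuclideanSpace ℂ (Fin m) := fun z => A (w z) - I • A (T z (w z))
  have hsmooth : ContDiffOn ℝ 2 h (ball 0 r) := by
    have h1 : ContDiffOn ℝ 2 w (ball 0 r) := hw.of_le (WithTop.coe_le_coe.mpr (le_top : (2 : ℕ∞) ≤ ⊤))
    have h2 : ContDiffOn ℝ 2 T (ball 0 r) := hT.of_le (WithTop.coe_le_coe.mpr (le_top : (2 : ℕ∞) ≤ ⊤))
    exact (A.contDiff.comp_contDiffOn h1).sub
      ((A.contDiff.comp_contDiffOn (h2.clm_apply h1)).const_smul I)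
  have hlow : ∀ z, ‖w z‖ ≤ K * ‖h z‖ := fun z => hA _ _
  have hfd : ∀ z ∈ ball (0 : ℂ) r, fderiv ℝ h z 1 + I • fderiv ℝ h z I =
      A (fderiv ℝ w z 1 + T z (fderiv ℝ w z I))
        - I • A (T z (fderiv ℝ w z 1 + T z (fderiv ℝ w z I)))
        - I • A (fderiv ℝ T z 1 (w z)) + A (fderiv ℝ T z I (w z)) := by
    intro z hz
    have h1 : HasFDerivAt w (fderiv ℝ w z) z :=
      ((hw.contDiffAt (isOpen_ball.mem_nhds hz)).differentiableAt (by simp)).hasFDerivAt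
    have h2 : HasFDerivAt T (fderiv ℝ T z) z :=
      ((hT.contDiffAt (isOpen_ball.mem_nhds hz)).differentiableAt (by simp)).hasFDerivAt
    have h3 : fderiv ℝ h z = _ := ((A.hasFDerivAt.comp z h1).fun_sub
      ((A.hasFDerivAt.comp z (h2.clm_apply h1)).fun_const_smul I)).fderiv
    rw [h3]
    ext i
    simp [hsq]
    linear_combination (-(A (fderiv ℝ T z I (w z)) i) - A (T z (fderiv ℝ w z I)) i) * I_mul_I
  obtain ⟨r', hr', hball⟩ := Metric.eventually_nhds_iff_ball.mp
    (((hD.and hb₁).and hb₂).and (ball_mem_nhds (0 : ℂ) hr))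
  have hDh : ∀ z ∈ ball (0 : ℂ) r', ‖fderiv ℝ h z 1 + I • fderiv ℝ h z I‖ ≤
      ‖A‖ * (C + c₁ * C + 2 * c₂) * K * ‖h z‖ := by
    intro z hz
    obtain ⟨⟨⟨h1, h2⟩, h3⟩, h4⟩ := hball z hz
    have hTd : ∀ v : ℂ, ‖v‖ = 1 → ‖fderiv ℝ T z v (w z)‖ ≤ c₂ * ‖w z‖ := fun v hv => by
      refine ContinuousLinearMap.le_of_opNorm_le _ ?_ _
      simpa [hv] using (fderiv ℝ T z).le_of_opNorm_le h3 v
    set p := fderiv ℝ w z 1 + T z (fderiv ℝ w z I)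
    have hTp : ‖T z p‖ ≤ c₁ * (C * ‖w z‖) := (T z).le_of_opNorm_le_of_le h2 h1
    rw [hfd z h4]
    calc _ ≤ ‖A p‖ + ‖A (T z p)‖ + ‖A (fderiv ℝ T z 1 (w z))‖ + ‖A (fderiv ℝ T z I (w z))‖ := by
          refine (norm_add_le _ _).trans (add_le_add ((norm_sub_le _ _).trans
            (add_le_add ((norm_sub_le _ _).trans (add_le_add le_rfl ?_)) ?_)) le_rfl)
          all_goals rw [norm_smul, norm_I, one_mul]
      _ ≤ ‖A‖ * (C * ‖w z‖) + ‖A‖ * (c₁ * (C * ‖w z‖)) + ‖A‖ * (c₂ * ‖w z‖)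
          + ‖A‖ * (c₂ * ‖w z‖) := by
          gcongr
          · exact A.le_opNorm_of_le h1
          · exact A.le_opNorm_of_le hTp
          · exact A.le_opNorm_of_le (hTd 1 norm_one)
          · exact A.le_opNorm_of_le (hTd I norm_I)
      _ = ‖A‖ * (C + c₁ * C + 2 * c₂) * ‖w z‖ := by ring
      _ ≤ ‖A‖ * (C + c₁ * C + 2 * c₂) * (K * ‖h z‖) := by
          gcongr
          exact hlow z
      _ = _ := by ring
  have hhw : h =O[𝓝 0] w := by
    refine Asymptotics.IsBigO.of_bound (‖A‖ + ‖A‖ * c₁) ?_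
    filter_upwards [hb₁] with z hz
    refine (norm_sub_le _ _).trans ?_
    rw [norm_smul, norm_I, one_mul, add_mul, mul_assoc]
    exact add_le_add (A.le_opNorm _) (A.le_opNorm_of_le ((T z).le_of_opNorm_le hz _))
  have hsub : ball (0 : ℂ) r' ⊆ ball 0 r := fun z hz => (hball z hz).2
  obtain ⟨ε, hε, hzero⟩ := eqOn_zero_of_norm_dbar_le hr' (hsmooth.mono hsub) (by positivity) hDh
    fun N => hhw.trans (isBigO_norm_pow_of_iteratedFDeriv_eq_zero hw0 hflat N)
  exact ⟨ε, hε, fun z hz => norm_le_zero_iff.mp (by simpa [hzero z hz] using hlow z)⟩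

end Pseudoholomorphic

/-- **Unique continuation for pseudoholomorphic curves.**  If `u, v : B → ℂⁿ` are smooth
`J`-holomorphic curves with `u(0) = v(0) = 0` whose iterated derivatives at `0` agree to
all orders, then `u ≡ v` on a neighborhood of `0`. -/
theorem pseudoholomorphic_unique_continuation (n : ℕ)
    (J : EuclideanSpace ℂ (Fin n) →
      (EuclideanSpace ℂ (Fin n) →L[ℝ] EuclideanSpace ℂ (Fin n)))
    (hJsmooth : ContDiff ℝ (⊤ : ℕ∞) J)
    (hJsq : ∀ x w, J x (J x w) = -w)
    (u v : ℂ → EuclideanSpace ℂ (Fin n))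
    (husmooth : ContDiffOn ℝ (⊤ : ℕ∞) u (ball 0 1))
    (hvsmooth : ContDiffOn ℝ (⊤ : ℕ∞) v (ball 0 1))
    (huCR : ∀ z ∈ ball (0 : ℂ) 1,
      fderiv ℝ u z 1 + J (u z) (fderiv ℝ u z Complex.I) = 0)
    (hvCR : ∀ z ∈ ball (0 : ℂ) 1,
      fderiv ℝ v z 1 + J (v z) (fderiv ℝ v z Complex.I) = 0)
    (hu0 : u 0 = 0) (hv0 : v 0 = 0)
    (hjet : ∀ k : ℕ, iteratedFDeriv ℝ k u 0 = iteratedFDeriv ℝ k v 0) :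
    ∃ ε : ℝ, 0 < ε ∧ Set.EqOn u v (ball 0 ε) := by
  have hnhds : ball (0 : ℂ) 1 ∈ 𝓝 (0 : ℂ) := ball_mem_nhds 0 one_pos
  have hu : ContDiffAt ℝ (⊤ : ℕ∞) u 0 := husmooth.contDiffAt hnhds
  have hv : ContDiffAt ℝ (⊤ : ℕ∞) v 0 := hvsmooth.contDiffAt hnhds
  obtain ⟨K, t, ht, hlip⟩ :=
    ((hJsmooth.contDiffAt (x := 0)).of_le (m := 1) (by simp)).exists_lipschitzOnWith
  obtain ⟨c, hc, hvc⟩ := eventually_norm_le_of_continuousAt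
    (hv.fderiv_right (m := 0) (by simp)).continuousAt
  have hut : ∀ᶠ z in 𝓝 0, u z ∈ t := hu.continuousAt (by rwa [hu0])
  have hvt : ∀ᶠ z in 𝓝 0, v z ∈ t := hv.continuousAt (by rwa [hv0])
  obtain ⟨ε, hε, hzero⟩ := eqOn_zero_of_norm_variable_dbar_le (w := u - v) (T := fun z => J (u z))
    (C := K * c) one_pos (husmooth.sub hvsmooth) (hJsmooth.comp_contDiffOn husmooth)
    (fun z => hJsq (u z)) (by positivity)
    (by
      filter_upwards [hut, hvt, hvc, hnhds] with z hz₁ hz₂ hz₃ hz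
      have hud := (husmooth.contDiffAt (isOpen_ball.mem_nhds hz)).differentiableAt (by simp)
      have hvd := (hvsmooth.contDiffAt (isOpen_ball.mem_nhds hz)).differentiableAt (by simp)
      have heq : fderiv ℝ (u - v) z 1 + J (u z) (fderiv ℝ (u - v) z I) =
          (J (v z) - J (u z)) (fderiv ℝ v z I) := by
        rw [fderiv_sub hud hvd]
        simp only [_root_.sub_apply, map_sub]
        rw [eq_neg_of_add_eq_zero_left (huCR z hz), eq_neg_of_add_eq_zero_left (hvCR z hz)]
        abel
      have hJ : ‖J (v z) - J (u z)‖ ≤ K * ‖(u - v) z‖ := by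
        rw [Pi.sub_apply, norm_sub_rev (u z)]
        exact hlip.norm_sub_le hz₂ hz₁
      have hI : ‖fderiv ℝ v z I‖ ≤ c := by
        simpa using (fderiv ℝ v z).le_of_opNorm_le hz₃ I
      rw [heq]
      calc _ ≤ K * ‖(u - v) z‖ * c := ContinuousLinearMap.le_of_opNorm_le_of_le _ hJ hI
        _ = _ := by ring)
    (fun k => by
      have hk : ((k : ℕ∞) : WithTop ℕ∞) ≤ ((⊤ : ℕ∞) : WithTop ℕ∞) := by exact_mod_cast le_top
      rw [iteratedFDeriv_sub_apply (hu.of_le hk) (hv.of_le hk), hjet, sub_self])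
  exact ⟨ε, hε, fun z hz => sub_eq_zero.mp (hzero z hz)⟩
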